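/- Let k be an algebraically closed field of characteristic different from 2, and let g, h ∈ k. In the algebra T(g,h): (1) the family (i,j,m,l) ↦ y^i·x^j·(wx)^m·w^l, for i, j, m ≥ 0 and l ∈ {0,1}, is a k-vector-space basis of T(g,h); and (2) the elements x² and y² are central in T(g,h). -/

import Mathlib

noncomputable section

open FreeAlgebra

/-- The generator `x` of the free algebra `k⟨x,y,w⟩`. -/
def Xf (k : Type*) [Field k] : FreeAlgebra k (Fin 3) := FreeAlgebra.ι k 0

/-- The generator `y` of the free algebra `k⟨x,y,w⟩`. -/
def Yf (k : Type*) [Field k] : FreeAlgebra k (Fin 3) := FreeAlgebra.ι k 1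

/-- The generator `w` of the free algebra `k⟨x,y,w⟩`. -/
def Wf (k : Type*) [Field k] : FreeAlgebra k (Fin 3) := FreeAlgebra.ι k 2

/-- The relations defining `T(g,h) = k⟨x,y,w⟩/⟨xy - yx, wy + yw - x² - g·y², w² + h·y²⟩`. -/
def Wrel (k : Type*) [Field k] (g h : k) :
    FreeAlgebra k (Fin 3) → FreeAlgebra k (Fin 3) → Prop := fun m n =>
  (m = Xf k * Yf k ∧ n = Yf k * Xf k) ∨
  (m = Wf k * Yf k + Yf k * Wf k ∧ n = (Xf k) ^ 2 + g • (Yf k) ^ 2) ∨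
  (m = (Wf k) ^ 2 ∧ n = -(h • (Yf k) ^ 2))

/-- The algebra `T(g,h)`. -/
abbrev Tgh (k : Type*) [Field k] (g h : k) := RingQuot (Wrel k g h)

/-- The image of `x` in `T(g,h)`. -/
def Wx (k : Type*) [Field k] (g h : k) : Tgh k g h :=
  RingQuot.mkAlgHom k (Wrel k g h) (Xf k)

/-- The image of `y` in `T(g,h)`. -/
def Wy (k : Type*) [Field k] (g h : k) : Tgh k g h :=
  RingQuot.mkAlgHom k (Wrel k g h) (Yf k)

/-- The image of `w` in `T(g,h)`. -/
def Ww (k : Type*) [Field k] (g h : k) : Tgh k g h :=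
  RingQuot.mkAlgHom k (Wrel k g h) (Wf k)

namespace Tgh

section Relations

variable {k : Type*} [Field k] (g h : k)

theorem x_mul_y : Wx k g h * Wy k g h = Wy k g h * Wx k g h := by
  simpa [Wx, Wy] using
    RingQuot.mkAlgHom_rel k (s := Wrel k g h) (Or.inl ⟨rfl, rfl⟩)

theorem w_mul_y_add : Ww k g h * Wy k g h + Wy k g h * Ww k g h =
    Wx k g h ^ 2 + g • Wy k g h ^ 2 := by
  simpa [Wx, Wy, Ww] using
    RingQuot.mkAlgHom_rel k (s := Wrel k g h) (Or.inr (Or.inl ⟨rfl, rfl⟩))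

theorem w_sq : Ww k g h ^ 2 = -(h • Wy k g h ^ 2) := by
  simpa [Wx, Wy, Ww] using
    RingQuot.mkAlgHom_rel k (s := Wrel k g h) (Or.inr (Or.inr ⟨rfl, rfl⟩))

end Relations

section Commutation

variable {k A : Type*} [Field k] [Ring A] [Algebra k A] {g h : k} {x y w : A}

theorem commute_w_y_sq (hxy : x * y = y * x) (hwy : w * y + y * w = x ^ 2 + g • y ^ 2) :
    Commute w (y ^ 2) := by
  have hc : (x ^ 2 + g • y ^ 2) * y = y * (x ^ 2 + g • y ^ 2) :=
    ((Commute.pow_left hxy 2).add_left ((Commute.pow_left rfl 2).smul_left g)).eq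
  rw [← hwy] at hc
  have : w * (y * y) = y * y * w := by
    simp only [add_mul, mul_add, mul_assoc] at hc
    rw [add_comm] at hc
    have := add_left_cancel hc
    simpa [mul_assoc] using this
  rwa [← pow_two] at this

theorem commute_w_x_sq (hxy : x * y = y * x) (hwy : w * y + y * w = x ^ 2 + g • y ^ 2)
    (hw : w ^ 2 = -(h • y ^ 2)) : Commute w (x ^ 2) := by
  have hx : x ^ 2 = w * y + y * w - g • y ^ 2 := by rw [hwy]; abel
  have hwwy : w * w * y = y * (w * w) := by
    rw [← pow_two, hw]
    exact ((Commute.pow_left (Commute.refl y) 2).smul_left h).neg_left.eq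
  have hc : Commute w (w * y + y * w) := by
    change w * (w * y + y * w) = (w * y + y * w) * w
    rw [mul_add, add_mul, ← mul_assoc w w y, hwwy]
    simp only [mul_assoc]
    abel
  rw [hx]
  exact hc.sub_right ((commute_w_y_sq hxy hwy).smul_right g)

theorem commute_sq_of_commute_mul_add {c : A} (hwy : w * y + y * w = c) (hc : Commute w c) :
    Commute (w ^ 2) y := by
  have hwy' := eq_sub_of_add_eq hwy
  change w ^ 2 * y = y * w ^ 2
  rw [pow_two, mul_assoc, hwy', mul_sub, hc.eq, ← mul_assoc, hwy', sub_mul, sub_sub_cancel,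
    mul_assoc]

theorem w_mul_w_mul (hw : w ^ 2 = -(h • y ^ 2)) (t : A) :
    w * (w * t) = -(h • (y * (y * t))) := by
  rw [← mul_assoc, ← pow_two, hw, neg_mul, smul_mul_assoc, pow_two, mul_assoc]

end Commutation

section Induction

variable {k : Type*} [Field k] {g h : k}

theorem induction_on {P : Tgh k g h → Prop} (t : Tgh k g h)
    (hc : ∀ c : k, P (algebraMap k _ c)) (hx : P (Wx k g h)) (hy : P (Wy k g h))
    (hw : P (Ww k g h)) (hmul : ∀ a b, P a → P b → P (a * b))
    (hadd : ∀ a b, P a → P b → P (a + b)) : P t := by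
  obtain ⟨f, rfl⟩ := RingQuot.mkAlgHom_surjective k (Wrel k g h) t
  induction f using FreeAlgebra.induction with
  | grade0 r => simpa using hc r
  | grade1 i => fin_cases i <;> assumption
  | mul a b ha hb => rw [map_mul]; exact hmul _ _ ha hb
  | add a b ha hb => rw [map_add]; exact hadd _ _ ha hb

theorem commute_of_generators {z : Tgh k g h} (hx : Commute z (Wx k g h))
    (hy : Commute z (Wy k g h)) (hw : Commute z (Ww k g h)) (t : Tgh k g h) : Commute z t :=
  induction_on t (fun c => Algebra.commute_algebraMap_right c z) hx hy hw
    (fun _ _ => Commute.mul_right) (fun _ _ => Commute.add_right)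

end Induction

section Spanning

variable {k : Type*} [Field k] (g h : k)

/-- The monomial `y^i x^j (wx)^m w^l`. -/
def monomial (p : ℕ × ℕ × ℕ × Fin 2) : Tgh k g h :=
  (Wy k g h) ^ p.1 * (Wx k g h) ^ p.2.1 * (Ww k g h * Wx k g h) ^ p.2.2.1 *
    (Ww k g h) ^ (p.2.2.2 : ℕ)

/-- The span of the monomials. -/
def monomialSpan : Submodule k (Tgh k g h) := Submodule.span k (Set.range (monomial g h))

variable {g h}

theorem monomial_mem (p : ℕ × ℕ × ℕ × Fin 2) : monomial g h p ∈ monomialSpan g h :=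
  Submodule.subset_span ⟨p, rfl⟩

theorem mul_mem_of_monomial {a : Tgh k g h}
    (ha : ∀ p, a * monomial g h p ∈ monomialSpan g h) {t : Tgh k g h}
    (ht : t ∈ monomialSpan g h) : a * t ∈ monomialSpan g h := by
  have : monomialSpan g h ≤ (monomialSpan g h).comap (LinearMap.mulLeft k a) :=
    Submodule.span_le.2 (by rintro _ ⟨p, rfl⟩; exact ha p)
  exact this ht

theorem y_mul_monomial (i j m : ℕ) (l : Fin 2) :
    Wy k g h * monomial g h (i, j, m, l) = monomial g h (i + 1, j, m, l) := by
  simp only [monomial, pow_succ', mul_assoc]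

theorem x_mul_monomial (i j m : ℕ) (l : Fin 2) :
    Wx k g h * monomial g h (i, j, m, l) = monomial g h (i, j + 1, m, l) := by
  have := (Commute.pow_right (x_mul_y g h : Commute (Wx k g h) (Wy k g h)) i).eq
  simp only [monomial, pow_succ' (Wx k g h), mul_assoc]
  rw [← mul_assoc, this, mul_assoc]

theorem x_mul_mem {t : Tgh k g h} (ht : t ∈ monomialSpan g h) :
    Wx k g h * t ∈ monomialSpan g h :=
  mul_mem_of_monomial (fun ⟨i, j, m, l⟩ => by
    rw [x_mul_monomial]
    exact monomial_mem _) ht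

theorem y_mul_mem {t : Tgh k g h} (ht : t ∈ monomialSpan g h) :
    Wy k g h * t ∈ monomialSpan g h :=
  mul_mem_of_monomial (fun ⟨i, j, m, l⟩ => by
    rw [y_mul_monomial]
    exact monomial_mem _) ht

theorem w_sq_mul_mem {t : Tgh k g h} (ht : t ∈ monomialSpan g h) :
    Ww k g h * (Ww k g h * t) ∈ monomialSpan g h := by
  rw [w_mul_w_mul (w_sq g h)]
  exact neg_mem (Submodule.smul_mem _ _ (y_mul_mem (y_mul_mem ht)))

theorem w_mul_monomial_zero_one (m : ℕ) (l : Fin 2) :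
    Ww k g h * monomial g h (0, 1, m, l) = monomial g h (0, 0, m + 1, l) := by
  simp [monomial, pow_succ', mul_assoc]

theorem w_mul_monomial_zero_zero_mem (m : ℕ) (l : Fin 2) :
    Ww k g h * monomial g h (0, 0, m, l) ∈ monomialSpan g h := by
  cases m with
  | zero =>
    fin_cases l
    · convert monomial_mem (g := g) (h := h) (0, 0, 0, 1) using 1
      simp [monomial]
    · convert w_sq_mul_mem (monomial_mem (g := g) (h := h) (0, 0, 0, 0)) using 1
      simp [monomial]
  | succ m =>
    rw [← w_mul_monomial_zero_one]
    exact w_sq_mul_mem (monomial_mem _)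

theorem w_mul_monomial_zero_mem (m : ℕ) (l : Fin 2) (j : ℕ) :
    Ww k g h * monomial g h (0, j, m, l) ∈ monomialSpan g h := by
  induction j using Nat.twoStepInduction with
  | zero => exact w_mul_monomial_zero_zero_mem m l
  | one => exact w_mul_monomial_zero_one (g := g) (h := h) m l ▸ monomial_mem _
  | more j ih _ =>
    rw [← x_mul_monomial, ← x_mul_monomial, ← mul_assoc (Wx k g h), ← pow_two, ← mul_assoc,
      (commute_w_x_sq (x_mul_y g h) (w_mul_y_add g h) (w_sq g h)).eq, pow_two, mul_assoc,
      mul_assoc]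
    exact x_mul_mem (x_mul_mem ih)

theorem w_mul_monomial_mem (i j m : ℕ) (l : Fin 2) :
    Ww k g h * monomial g h (i, j, m, l) ∈ monomialSpan g h := by
  induction i with
  | zero => exact w_mul_monomial_zero_mem m l j
  | succ i ih =>
    rw [← y_mul_monomial, ← mul_assoc, eq_sub_of_add_eq (w_mul_y_add g h), sub_mul, add_mul,
      smul_mul_assoc, pow_two, pow_two, mul_assoc, mul_assoc, mul_assoc]
    have hm := monomial_mem (g := g) (h := h) (i, j, m, l)
    exact sub_mem (add_mem (x_mul_mem (x_mul_mem hm))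
      (Submodule.smul_mem _ _ (y_mul_mem (y_mul_mem hm)))) (y_mul_mem ih)

theorem w_mul_mem {t : Tgh k g h} (ht : t ∈ monomialSpan g h) :
    Ww k g h * t ∈ monomialSpan g h :=
  mul_mem_of_monomial (fun ⟨i, j, m, l⟩ => w_mul_monomial_mem i j m l) ht

theorem monomialSpan_eq_top : monomialSpan g h = ⊤ := by
  refine eq_top_iff.2 fun t _ => ?_
  have key : ∀ s ∈ monomialSpan g h, t * s ∈ monomialSpan g h := by
    refine induction_on (P := fun t => ∀ s ∈ monomialSpan g h, t * s ∈ monomialSpan g h) t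
      (fun c s hs => ?_) (fun _ => x_mul_mem)
      (fun _ => y_mul_mem) (fun _ => w_mul_mem)
      (fun a b ha hb s hs => ?_) (fun a b ha hb s hs => ?_)
    · rw [← Algebra.smul_def]
      exact Submodule.smul_mem _ _ hs
    · rw [mul_assoc]
      exact ha _ (hb _ hs)
    · rw [add_mul]
      exact add_mem (ha _ hs) (hb _ hs)
  have h1 : (1 : Tgh k g h) ∈ monomialSpan g h := by
    simpa [monomial] using monomial_mem (g := g) (h := h) (0, 0, 0, 0)
  simpa using key 1 h1

end Spanning

section Representation

variable (k : Type*) [Field k]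

/-- The vector space with basis indexed by the exponents of the monomials. -/
abbrev Model := (ℕ × ℕ × ℕ × Fin 2) →₀ k

/-- The basis vector of `Model k` corresponding to `y^i x^j (wx)^m w^l`. -/
def basisVec (i j m : ℕ) (l : Fin 2) : Model k := Finsupp.single (i, j, m, l) 1

variable {k}

/-- The endomorphism of `Model k` with prescribed values on the basis vectors. -/
def endOfBasis (f : ℕ → ℕ → ℕ → Fin 2 → Model k) : Module.End k (Model k) :=
  Finsupp.linearCombination k fun p => f p.1 p.2.1 p.2.2.1 p.2.2.2

@[simp]
theorem endOfBasis_basisVec (f : ℕ → ℕ → ℕ → Fin 2 → Model k) (i j m : ℕ) (l : Fin 2) :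
    endOfBasis f (basisVec k i j m l) = f i j m l := by
  simp [endOfBasis, basisVec]

theorem end_ext {a b : Module.End k (Model k)}
    (H : ∀ i j m l, a (basisVec k i j m l) = b (basisVec k i j m l)) : a = b := by
  refine Finsupp.lhom_ext' fun p => LinearMap.ext_ring ?_
  exact H p.1 p.2.1 p.2.2.1 p.2.2.2

variable (k)

/-- Left multiplication by `x` on the model. -/
def opX : Module.End k (Model k) := endOfBasis fun i j m l => basisVec k i (j + 1) m l

/-- Left multiplication by `y` on the model. -/
def opY : Module.End k (Model k) := endOfBasis fun i j m l => basisVec k (i + 1) j m l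

variable {k} (g h : k)

/-- The product of `w` with `x^j (wx)^m w^l`. -/
def wMulAux : ℕ → ℕ → Fin 2 → Model k
  | 0, 0, 0 => basisVec k 0 0 0 1
  | 0, 0, 1 => -(h • basisVec k 2 0 0 0)
  | 0, m + 1, l => -(h • basisVec k 2 1 m l)
  | 1, m, l => basisVec k 0 0 (m + 1) l
  | j + 2, m, l => (opX k ^ 2) (wMulAux j m l)

/-- The product of `w` with `y^i x^j (wx)^m w^l`. -/
def wMul : ℕ → ℕ → ℕ → Fin 2 → Model k
  | 0, j, m, l => wMulAux h j m l
  | i + 1, j, m, l => (opX k ^ 2 + g • opY k ^ 2) (basisVec k i j m l) - opY k (wMul i j m l)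

/-- Left multiplication by `w` on the model. -/
def opW : Module.End k (Model k) := endOfBasis (wMul g h)

@[simp]
theorem opX_basisVec (i j m : ℕ) (l : Fin 2) :
    opX k (basisVec k i j m l) = basisVec k i (j + 1) m l := by
  simp [opX]

@[simp]
theorem opY_basisVec (i j m : ℕ) (l : Fin 2) :
    opY k (basisVec k i j m l) = basisVec k (i + 1) j m l := by
  simp [opY]

theorem opW_basisVec (i j m : ℕ) (l : Fin 2) :
    opW g h (basisVec k i j m l) = wMul g h i j m l := by
  simp [opW]

theorem opX_mul_opY : opX k * opY k = opY k * opX k :=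
  end_ext fun i j m l => by simp

theorem opW_mul_opY_add :
    opW g h * opY k + opY k * opW g h = opX k ^ 2 + g • opY k ^ 2 :=
  end_ext fun i j m l => by
    rw [LinearMap.add_apply, Module.End.mul_apply, Module.End.mul_apply, opY_basisVec,
      opW_basisVec, opW_basisVec, wMul, sub_add_cancel]

theorem opW_opY (v : Model k) :
    opW g h (opY k v) = (opX k ^ 2 + g • opY k ^ 2) v - opY k (opW g h v) := by
  rw [← opW_mul_opY_add g h]
  simp

theorem opW_mul_opX_sq : opW g h * opX k ^ 2 = opX k ^ 2 * opW g h := by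
  refine end_ext fun i j m l => ?_
  induction i with
  | zero =>
    have : (opX k ^ 2) (basisVec k 0 j m l) = basisVec k 0 (j + 2) m l := by simp [pow_two]
    rw [Module.End.mul_apply, Module.End.mul_apply, this, opW_basisVec, opW_basisVec, wMul, wMul,
      wMulAux]
  | succ i ih =>
    have hxy : Commute (opX k ^ 2) (opY k) := Commute.pow_left opX_mul_opY 2
    have hc : Commute (opX k ^ 2) (opX k ^ 2 + g • opY k ^ 2) :=
      (Commute.refl _).add_right ((hxy.pow_right 2).smul_right g)
    have hxy' (v : Model k) : (opX k ^ 2) (opY k v) = opY k ((opX k ^ 2) v) :=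
      LinearMap.congr_fun hxy.eq v
    have hc' (v : Model k) : (opX k ^ 2) ((opX k ^ 2 + g • opY k ^ 2) v) =
        (opX k ^ 2 + g • opY k ^ 2) ((opX k ^ 2) v) :=
      LinearMap.congr_fun hc.eq v
    rw [Module.End.mul_apply, Module.End.mul_apply] at ih ⊢
    rw [← opY_basisVec, hxy', opW_opY, opW_opY, map_sub, ih, hc', hxy']

theorem opW_commute_opY_sq : Commute (opW g h) (opY k ^ 2) :=
  commute_w_y_sq (A := Module.End k (Model k)) opX_mul_opY (opW_mul_opY_add g h)

theorem opW_sq_mul_opY : opW g h ^ 2 * opY k = opY k * opW g h ^ 2 := by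
  have hc : Commute (opW g h) (opX k ^ 2 + g • opY k ^ 2) :=
    Commute.add_right (opW_mul_opX_sq g h) ((opW_commute_opY_sq g h).smul_right g)
  exact commute_sq_of_commute_mul_add (A := Module.End k (Model k)) (opW_mul_opY_add g h) hc

theorem opW_sq_basisVec_zero_one (m : ℕ) (l : Fin 2) :
    (opW g h ^ 2) (basisVec k 0 1 m l) = -(h • basisVec k 2 1 m l) := by
  simp [pow_two, opW_basisVec, wMul, wMulAux]

theorem opW_basisVec_two (j m : ℕ) (l : Fin 2) :
    opW g h (basisVec k 2 j m l) = (opY k ^ 2) (opW g h (basisVec k 0 j m l)) := by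
  have := LinearMap.congr_fun (opW_commute_opY_sq g h).eq
    (basisVec k 0 j m l)
  simpa [pow_two] using this

theorem opW_sq_basisVec_zero_zero (m : ℕ) (l : Fin 2) :
    (opW g h ^ 2) (basisVec k 0 0 m l) = -(h • basisVec k 2 0 m l) := by
  rw [pow_two, Module.End.mul_apply, opW_basisVec g h 0 0 m l]
  cases m with
  | zero =>
    fin_cases l <;>
      simp [wMul, wMulAux, opW_basisVec_two, opW_basisVec g h 0, pow_two]
  | succ m => simp [wMul, wMulAux, opW_basisVec_two, opW_basisVec g h 0, pow_two]

theorem opW_sq_basisVec_zero (m : ℕ) (l : Fin 2) (j : ℕ) :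
    (opW g h ^ 2) (basisVec k 0 j m l) = -(h • basisVec k 2 j m l) := by
  induction j using Nat.twoStepInduction with
  | zero => exact opW_sq_basisVec_zero_zero g h m l
  | one => exact opW_sq_basisVec_zero_one g h m l
  | more j ih _ =>
    have hx (i : ℕ) : basisVec k i (j + 2) m l = (opX k ^ 2) (basisVec k i j m l) := by
      simp [pow_two]
    have hc : Commute (opW g h ^ 2) (opX k ^ 2) := Commute.pow_left (opW_mul_opX_sq g h) 2
    rw [hx, hx, ← Module.End.mul_apply, hc.eq, Module.End.mul_apply, ih, map_neg, map_smul]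

theorem opW_sq : opW g h ^ 2 = -(h • opY k ^ 2) := by
  refine end_ext fun i j m l => ?_
  have hy : (-(h • opY k ^ 2)) (basisVec k i j m l) = -(h • basisVec k (i + 2) j m l) := by
    simp [pow_two]
  rw [hy]
  clear hy
  induction i with
  | zero => exact opW_sq_basisVec_zero g h m l j
  | succ i ih =>
    rw [← opY_basisVec, ← Module.End.mul_apply, opW_sq_mul_opY, Module.End.mul_apply, ih, map_neg,
      map_smul, opY_basisVec]

/-- The representation of `T(g,h)` on the model. -/
def rep : Tgh k g h →ₐ[k] Module.End k (Model k) :=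
  RingQuot.liftAlgHom k ⟨FreeAlgebra.lift k ![opX k, opY k, opW g h], by
    rintro _ _ (⟨rfl, rfl⟩ | ⟨rfl, rfl⟩ | ⟨rfl, rfl⟩)
    · simpa [Xf, Yf] using opX_mul_opY
    · simpa [Xf, Yf, Wf] using opW_mul_opY_add g h
    · simpa [Yf, Wf] using opW_sq g h⟩

@[simp]
theorem rep_x : rep g h (Wx k g h) = opX k := by
  simp [rep, Wx, Xf]

@[simp]
theorem rep_y : rep g h (Wy k g h) = opY k := by
  simp [rep, Wy, Yf]

@[simp]
theorem rep_w : rep g h (Ww k g h) = opW g h := by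
  simp [rep, Ww, Wf]

theorem rep_monomial (i j m : ℕ) (l : Fin 2) :
    rep g h (monomial g h (i, j, m, l)) (basisVec k 0 0 0 0) = basisVec k i j m l := by
  have hw : (opW g h ^ (l : ℕ)) (basisVec k 0 0 0 0) = basisVec k 0 0 0 l := by
    fin_cases l <;> simp [opW_basisVec, wMul, wMulAux]
  have hwx : ((opW g h * opX k) ^ m) (basisVec k 0 0 0 l) = basisVec k 0 0 m l := by
    induction m with
    | zero => simp
    | succ m ih => simp [pow_succ', ih, opW_basisVec, wMul, wMulAux]
  have hx : (opX k ^ j) (basisVec k 0 0 m l) = basisVec k 0 j m l := by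
    induction j with
    | zero => simp
    | succ j ih => simp [pow_succ', ih]
  have hy : (opY k ^ i) (basisVec k 0 j m l) = basisVec k i j m l := by
    induction i with
    | zero => simp
    | succ i ih => simp [pow_succ', ih]
  simp only [monomial, map_mul, map_pow, rep_x, rep_y, rep_w, Module.End.mul_apply]
  rw [hw, hwx, hx, hy]

theorem linearIndependent_monomial : LinearIndependent k (monomial g h) := by
  refine LinearIndependent.of_comp
    ((LinearMap.applyₗ (basisVec k 0 0 0 0)).comp (rep g h).toLinearMap) ?_
  convert (Finsupp.basisSingleOne (R := k) (ι := ℕ × ℕ × ℕ × Fin 2)).linearIndependent using 1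
  ext1 ⟨i, j, m, l⟩
  simpa [basisVec] using rep_monomial g h i j m l

end Representation

end Tgh

/-- In `T(g,h)`: the family `(i,j,m,l) ↦ y^i x^j (wx)^m w^l` (with `l ∈ {0,1}`) is a
`k`-vector-space basis, and `x²` and `y²` are central. -/
theorem stmt18 {k : Type*} [Field k] [IsAlgClosed k] (hchar : ringChar k ≠ 2) (g h : k) :
    (LinearIndependent k
        (fun p : ℕ × ℕ × ℕ × Fin 2 =>
          (Wy k g h) ^ p.1 * (Wx k g h) ^ p.2.1 * (Ww k g h * Wx k g h) ^ p.2.2.1 *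
            (Ww k g h) ^ (p.2.2.2 : ℕ)) ∧
      Submodule.span k
        (Set.range fun p : ℕ × ℕ × ℕ × Fin 2 =>
          (Wy k g h) ^ p.1 * (Wx k g h) ^ p.2.1 * (Ww k g h * Wx k g h) ^ p.2.2.1 *
            (Ww k g h) ^ (p.2.2.2 : ℕ)) = ⊤) ∧
    (∀ t : Tgh k g h, (Wx k g h) ^ 2 * t = t * (Wx k g h) ^ 2 ∧
      (Wy k g h) ^ 2 * t = t * (Wy k g h) ^ 2) := by
  refine ⟨⟨Tgh.linearIndependent_monomial g h, Tgh.monomialSpan_eq_top⟩, fun t => ⟨?_, ?_⟩⟩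
  · exact Tgh.commute_of_generators (Commute.pow_left rfl 2)
      (Commute.pow_left (Tgh.x_mul_y g h) 2)
      (Tgh.commute_w_x_sq (Tgh.x_mul_y g h) (Tgh.w_mul_y_add g h) (Tgh.w_sq g h)).symm t
  · exact Tgh.commute_of_generators (Commute.pow_left (Tgh.x_mul_y g h).symm 2)
      (Commute.pow_left rfl 2)
      (Tgh.commute_w_y_sq (Tgh.x_mul_y g h) (Tgh.w_mul_y_add g h)).symm t
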